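/- arXiv:2202.08653 — 4 statements merged into one kernel-verified Lean document; each statement's English description precedes it below -/
import Mathlib

section
/- Let (φ_i)_{i∈I} be a family of convex monotone functionals φ_i : C_κ → ℝ with φ_i(0) = 0 and sup_{i∈I} sup_{f ∈ B_{C_κ}(r)} |φ_i(f)| < ∞ for every r ≥ 0. Then the following are equivalent: (i) sup_{i∈I} φ_i(f_n) ↓ 0 for every sequence (f_n) ⊂ C_κ decreasing pointwise to 0; (ii) for every ε > 0 and r ≥ 0 there exist c ≥ 0 and a compact set K ⊂ X such that |φ_i(f) − φ_i(g)| ≤ c·sup_{x∈K}|f(x) − g(x)| + ε for all i ∈ I and all f, g ∈ B_{C_κ}(r). -/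
open Filter MeasureTheory Topology
open scoped ENNReal Topology

noncomputable section

def ecoe {X : Type*} (f : X → ℝ) : X → EReal := fun x => (f x : EReal)

variable {X : Type*} [MetricSpace X]

/-- membership in `C_κ` -/
def MemCk (κ : X → ℝ) (f : X → ℝ) : Prop :=
  Continuous f ∧ ∃ r : ℝ, ∀ x, |f x| * κ x ≤ r

/-- `‖f‖_κ ≤ r` -/
def CkBound (κ : X → ℝ) (r : ℝ) (f : X → ℝ) : Prop := ∀ x, |f x| * κ x ≤ r

/-- extended `κ`-norm of an `EReal`-valued function -/
def eknorm (κ : X → ℝ) (f : X → EReal) : ℝ≥0∞ :=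
  ⨆ x, (f x).abs * ENNReal.ofReal (κ x)

/-- positive part of an `EReal`-valued function -/
def epos {X : Type*} (f : X → EReal) : X → EReal := fun x => max (f x) 0

/-- membership in `U_κ` -/
def MemUk (κ : X → ℝ) (f : X → EReal) : Prop :=
  UpperSemicontinuous f ∧ (∀ x, f x < ⊤) ∧
    ∃ r : ℝ, ∀ x, max (f x) 0 * (κ x : EReal) ≤ (r : EReal)

/-- `Γ`-limsup of a sequence of functions -/
def gammaLimsup (f : ℕ → X → EReal) (x : X) : EReal :=
  ⨆ (u : ℕ → X) (_ : Tendsto u atTop (𝓝 x)),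
    Filter.limsup (fun n => f n (u n)) atTop

/-- `g = Γ-lim f_n` -/
def IsGammaLim (f : ℕ → X → EReal) (g : X → EReal) : Prop :=
  ∀ x : X,
    (∀ u : ℕ → X, Tendsto u atTop (𝓝 x) →
      Filter.limsup (fun n => f n (u n)) atTop ≤ g x) ∧
    (∃ u : ℕ → X, Tendsto u atTop (𝓝 x) ∧
      Tendsto (fun n => f n (u n)) atTop (𝓝 (g x)))

/-- `Γ`-limsup as `h ↓ 0` -/
def gammaLimsupZero (F : ℝ → X → EReal) (x : X) : EReal :=
  ⨆ (h : ℕ → ℝ) (_ : ∀ n, 0 < h n) (_ : Tendsto h atTop (𝓝 (0:ℝ))),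
    gammaLimsup (fun n => F (h n)) x

/-- `Γ`-limsup as `s → t`, `s ≥ 0` -/
def gammaLimsupAt (F : ℝ → X → EReal) (t : ℝ) (x : X) : EReal :=
  ⨆ (s : ℕ → ℝ) (_ : ∀ n, 0 ≤ s n) (_ : Tendsto s atTop (𝓝 t)),
    gammaLimsup (fun n => F (s n)) x

/-- Assumption S on a family of operators on `U_κ` -/
structure AssumptionS (κ : X → ℝ) (S : ℝ → (X → EReal) → (X → EReal)) : Prop where
  monotone : ∀ t, 0 ≤ t → ∀ f g, MemUk κ f → MemUk κ g →
    (∀ x, f x ≤ g x) → ∀ x, S t f x ≤ S t g x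
  convex : ∀ t, 0 ≤ t → ∀ f g, MemUk κ f → MemUk κ g → ∀ lam : ℝ, 0 ≤ lam → lam ≤ 1 →
    ∀ x, S t (fun y => (lam : EReal) * f y + ((1 - lam : ℝ) : EReal) * g y) x
      ≤ (lam : EReal) * S t f x + ((1 - lam : ℝ) : EReal) * S t g x
  zero : ∀ t, 0 ≤ t → ∀ x, S t (fun _ => (0 : EReal)) x = 0
  maps : ∀ t, 0 ≤ t → ∀ f, MemUk κ f → MemUk κ (S t f)
  contAbove : ∀ t, 0 ≤ t → ∀ (f : ℕ → X → EReal) (g : X → EReal),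
    (∀ n, MemUk κ (f n)) → MemUk κ g →
    (∀ x, Antitone fun n => f n x) → (∀ x, (⨅ n, f n x) = g x) →
    ∀ x, (⨅ n, S t (f n) x) = S t g x
  gammaUsc : ∀ t, 0 ≤ t → ∀ f, MemUk κ f →
    ∀ x, gammaLimsupAt (fun s => S s f) t x ≤ S t f x
  idZero : ∀ f, MemUk κ f → S 0 f = f
  bounded : ∀ r t : ℝ, 0 ≤ r → 0 ≤ t → ∃ C : ℝ≥0∞, C ≠ ⊤ ∧
    ∀ s, 0 ≤ s → s ≤ t → ∀ f : X → ℝ, MemCk κ f → CkBound κ r f →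
      eknorm κ (S s (ecoe f)) ≤ C

/-- an `EReal`-valued function which belongs to `C_κ` -/
def IsCk (κ : X → ℝ) (F : X → EReal) : Prop :=
  ∃ g : X → ℝ, MemCk κ g ∧ ∀ x, F x = (g x : EReal)

/-- the upper Lipschitz set `L^S_+` -/
def UpperLip (κ : X → ℝ) (S : ℝ → (X → EReal) → (X → EReal)) (f : X → ℝ) : Prop :=
  MemCk κ f ∧
  (∀ t, 0 ≤ t → IsCk κ (S t (ecoe f))) ∧
  (∀ s t, 0 ≤ s → 0 ≤ t → S (s + t) (ecoe f) = S s (S t (ecoe f))) ∧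
  ∃ h₀ > (0:ℝ), ∃ c ≥ (0:ℝ), ∀ h, 0 ≤ h → h ≤ h₀ → ∀ x,
    max (S h (ecoe f) x - (f x : EReal)) 0 * (κ x : EReal) ≤ ((c * h : ℝ) : EReal)

/-- the (two-sided) Lipschitz set `L^S` -/
def LipSet (κ : X → ℝ) (S : ℝ → (X → EReal) → (X → EReal)) (f : X → ℝ) : Prop :=
  MemCk κ f ∧
  (∀ t, 0 ≤ t → IsCk κ (S t (ecoe f))) ∧
  (∀ s t, 0 ≤ s → 0 ≤ t → S (s + t) (ecoe f) = S s (S t (ecoe f))) ∧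
  ∃ h₀ > (0:ℝ), ∃ c ≥ (0:ℝ), ∀ h, 0 ≤ h → h ≤ h₀ → ∀ x,
    (S h (ecoe f) x - (f x : EReal)).abs * ENNReal.ofReal (κ x) ≤ ENNReal.ofReal (c * h)

/-- difference quotient `(S(h)f - f)/h` -/
def diffQuot (S : ℝ → (X → EReal) → (X → EReal)) (f : X → ℝ) (h : ℝ) : X → EReal :=
  fun x => ((h⁻¹ : ℝ) : EReal) * (S h (ecoe f) x - (f x : EReal))

/-- the upper `Γ`-generator `A_Γ⁺` -/
def uppGen (S : ℝ → (X → EReal) → (X → EReal)) (f : X → ℝ) : X → EReal :=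
  fun x => gammaLimsupZero (fun h => diffQuot S f h) x

/-- `g = A_Γ f`, i.e. the `Γ`-limit of the difference quotients exists and equals `g` -/
def IsGammaDeriv (S : ℝ → (X → EReal) → (X → EReal)) (f : X → ℝ) (g : X → EReal) : Prop :=
  ∀ h : ℕ → ℝ, (∀ n, 0 < h n) → Tendsto h atTop (𝓝 (0:ℝ)) →
    IsGammaLim (fun n => diffQuot S f (h n)) g

/-- `g = Af` in the mixed topology -/
def MixedDeriv (κ : X → ℝ) (S : ℝ → (X → EReal) → (X → EReal)) (f : X → ℝ) (g : X → ℝ) : Prop :=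
  (∃ h₀ > (0:ℝ), ∃ r : ℝ, ∀ h, 0 < h → h ≤ h₀ → ∀ x,
      |h⁻¹ * ((S h (ecoe f) x).toReal - f x)| * κ x ≤ r) ∧
  ∀ K : Set X, IsCompact K → ∀ ε > (0:ℝ), ∃ h₀ > (0:ℝ), ∀ h, 0 < h → h ≤ h₀ → ∀ x ∈ K,
    |h⁻¹ * ((S h (ecoe f) x).toReal - f x) - g x| ≤ ε

/-- upper `ε`-parallel function -/
def parallel (κ : X → ℝ) (f : X → EReal) (ε : ℝ) : X → EReal :=
  fun x => (((κ x)⁻¹ : ℝ) : EReal) *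
    ((⨆ y ∈ Metric.closedBall x ε, max (f y * (κ y : EReal)) (((-ε⁻¹ : ℝ)) : EReal)) + (ε : EReal))

/-- upper semicontinuous envelope of the upper `ε`-parallel function -/
def parallelEnv (κ : X → ℝ) (f : X → EReal) (ε : ℝ) : X → EReal :=
  fun x => ⨅ (δ : ℝ) (_ : 0 < δ), ⨆ y ∈ Metric.closedBall x δ, parallel κ f ε y

end

noncomputable section

/-- truncation of an extended real to `ℝ≥0∞` -/
def erealToENNReal (x : EReal) : ℝ≥0∞ := if x = ⊤ then ⊤ else ENNReal.ofReal x.toReal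

/-- Lebesgue integral of an `EReal`-valued function on `(a,b]`, with values in `[-∞,∞]` -/
def eIntegral (a b : ℝ) (F : ℝ → EReal) : EReal :=
  ((∫⁻ s in Set.Ioc a b, erealToENNReal (max (F s) 0)) : ℝ≥0∞) -
  ((∫⁻ s in Set.Ioc a b, erealToENNReal (max (-F s) 0)) : ℝ≥0∞)

/-- convolution `f * μ` of an `EReal`-valued function with a measure -/
def econv {X : Type*} [NormedAddCommGroup X] [MeasurableSpace X]
    (μ : Measure X) (f : X → EReal) (x : X) : EReal :=
  ((∫⁻ y, erealToENNReal (max (f (x - y)) 0) ∂μ : ℝ≥0∞) : EReal) -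
  ((∫⁻ y, erealToENNReal (max (-f (x - y)) 0) ∂μ : ℝ≥0∞) : EReal)

/-- conjugate functional `φ*` -/
def dualConj {X : Type*} [MetricSpace X] [MeasurableSpace X]
    (κ : X → ℝ) (φ : (X → ℝ) → ℝ) (μ : Measure X) : EReal :=
  ⨆ f : {g : X → ℝ // MemCk κ g}, (((∫ x, f.1 x ∂μ) : ℝ) : EReal) - ((φ f.1 : ℝ) : EReal)

/-- the topology `σ(ca_κ⁺, C_κ)` on measures -/
def weakTopo {X : Type*} [MetricSpace X] [MeasurableSpace X] (κ : X → ℝ) :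
    TopologicalSpace (Measure X) :=
  TopologicalSpace.induced
    (fun μ => fun f : {g : X → ℝ // MemCk κ g} => ∫ x, f.1 x ∂μ) Pi.topologicalSpace

/-- `φ₁`, the extension of `φ` from `C_κ` to `U_κ` -/
def extUk {X : Type*} [MetricSpace X] (κ : X → ℝ) (φ : (X → ℝ) → ℝ) (f : X → EReal) : EReal :=
  ⨅ g : {g : X → ℝ // MemCk κ g ∧ ∀ x, f x ≤ (g x : EReal)}, ((φ g.1 : ℝ) : EReal)

end

section helpers

variable {X : Type*} [MetricSpace X] {κ : X → ℝ}

lemma MemCk.cmul {f : X → ℝ} (hf : MemCk κ f) (a : ℝ) : MemCk κ (fun x => a * f x) := by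
  obtain ⟨hc, r, hr⟩ := hf
  refine ⟨continuous_const.mul hc, |a| * r, fun x => ?_⟩
  rw [abs_mul, mul_assoc]
  exact mul_le_mul_of_nonneg_left (hr x) (abs_nonneg a)

lemma MemCk.add' (hκpos : ∀ x, 0 < κ x) {f g : X → ℝ} (hf : MemCk κ f) (hg : MemCk κ g) :
    MemCk κ (fun x => f x + g x) := by
  obtain ⟨hc, r, hr⟩ := hf
  obtain ⟨hc', r', hr'⟩ := hg
  refine ⟨hc.add hc', r + r', fun x => ?_⟩
  have := mul_le_mul_of_nonneg_right (abs_add_le (f x) (g x)) (hκpos x).le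
  have := hr x
  have := hr' x
  linarith

lemma MemCk.pos {f : X → ℝ} (hκpos : ∀ x, 0 < κ x) (hf : MemCk κ f) :
    MemCk κ (fun x => max (f x) 0) := by
  obtain ⟨hc, r, hr⟩ := hf
  refine ⟨hc.max continuous_const, r, fun x => le_trans ?_ (hr x)⟩
  refine mul_le_mul_of_nonneg_right ?_ (hκpos x).le
  rw [abs_of_nonneg (le_max_right _ _)]
  exact max_le (le_abs_self _) (abs_nonneg _)

lemma MemCk.const (hκpos : ∀ x, 0 < κ x) {C : ℝ} (hC : ∀ x, κ x ≤ C) (a : ℝ) :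
    MemCk κ (fun _ => a) :=
  ⟨continuous_const, |a| * C, fun x => mul_le_mul_of_nonneg_left (hC x) (abs_nonneg a)⟩

lemma MemCk.zero' : MemCk κ (fun _ => (0:ℝ)) :=
  ⟨continuous_const, 0, fun x => by simp⟩

lemma MemCk.sum (hκpos : ∀ x, 0 < κ x) {u : ℕ → X → ℝ} (hu : ∀ n, MemCk κ (u n)) (N k : ℕ) :
    MemCk κ (fun x => ∑ j ∈ Finset.range N, u (k + j) x) := by
  induction N with
  | zero => simpa using MemCk.zero'
  | succ N ih =>
    simp only [Finset.sum_range_succ]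
    exact ih.add' hκpos (hu _)

/-- dyadic convexity estimate -/
lemma sum_bound (hκpos : ∀ x, 0 < κ x) (φ : (X → ℝ) → ℝ)
    (hconv : ∀ f g, MemCk κ f → MemCk κ g → ∀ lam : ℝ, 0 ≤ lam → lam ≤ 1 →
        φ (fun y => lam * f y + (1 - lam) * g y) ≤ lam * φ f + (1 - lam) * φ g)
    (hzero : φ (fun _ => 0) = 0) {u : ℕ → X → ℝ} (hu : ∀ n, MemCk κ (u n)) {ε : ℝ} (hε : 0 ≤ ε)
    (h : ∀ n, φ (fun x => 2 ^ (n + 1) * u n x) ≤ ε) (N : ℕ) :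
    ∀ k, φ (fun x => 2 ^ k * ∑ j ∈ Finset.range N, u (k + j) x) ≤ ε := by
  induction N with
  | zero => intro k; simpa [hzero] using hε
  | succ N ih =>
    intro k
    have h1 := hconv (fun x => 2 ^ (k + 1) * u k x)
      (fun x => 2 ^ (k + 1) * ∑ j ∈ Finset.range N, u (k + 1 + j) x)
      ((hu k).cmul _) ((MemCk.sum hκpos hu N (k+1)).cmul _) (1/2) (by norm_num) (by norm_num)
    have h2 := h k
    have h3 := ih (k + 1)
    have e : (fun x => (2:ℝ) ^ k * ∑ j ∈ Finset.range (N + 1), u (k + j) x) =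
        (fun y => (1/2 : ℝ) * (2 ^ (k + 1) * u k y) +
          (1 - 1/2) * (2 ^ (k + 1) * ∑ j ∈ Finset.range N, u (k + 1 + j) y)) := by
      funext x
      rw [Finset.sum_range_succ']
      have h5 : ∑ j ∈ Finset.range N, u (k + (j + 1)) x =
          ∑ j ∈ Finset.range N, u (k + 1 + j) x :=
        Finset.sum_congr rfl fun j _ => by
          rw [show k + (j + 1) = k + 1 + j by omega]
      rw [h5, add_zero]
      ring
    rw [e]
    linarith

/-- Lipschitz estimate on balls -/
lemma lip_bound (hκpos : ∀ x, 0 < κ x) (φ : (X → ℝ) → ℝ)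
    (hconv : ∀ f g, MemCk κ f → MemCk κ g → ∀ lam : ℝ, 0 ≤ lam → lam ≤ 1 →
        φ (fun y => lam * f y + (1 - lam) * g y) ≤ lam * φ f + (1 - lam) * φ g)
    {R C : ℝ} (hC : ∀ f, MemCk κ f → CkBound κ (R + 1) f → |φ f| ≤ C)
    {f g : X → ℝ} (hf : MemCk κ f) (hg : MemCk κ g) (hfR : CkBound κ R f) (hgR : CkBound κ R g)
    {t : ℝ} (ht : 0 ≤ t) (hfg : ∀ x, |f x - g x| * κ x ≤ t) :
    φ f - φ g ≤ 2 * C * t := by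
  have hfC := abs_le.1 (hC f hf (fun x => (hfR x).trans (by linarith)))
  have hgC := abs_le.1 (hC g hg (fun x => (hgR x).trans (by linarith)))
  rcases ht.eq_or_lt with h0 | h0
  · have : f = g := by
      funext x
      have h1 := hfg x
      rw [← h0] at h1
      have h2 : |f x - g x| ≤ 0 := by
        by_contra hn
        push Not at hn
        have := mul_pos hn (hκpos x)
        linarith
      have := abs_nonpos_iff.1 h2
      linarith
    rw [this, ← h0]; simp
  · rcases le_total t 1 with h1 | h1
    · set q : X → ℝ := fun x => g x + t⁻¹ * (f x + (-1) * g x) with hq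
      have hqm : MemCk κ q := hg.add' hκpos ((hf.add' hκpos (hg.cmul (-1))).cmul t⁻¹)
      have hqb : CkBound κ (R + 1) q := by
        intro x
        have a1 := mul_le_mul_of_nonneg_right
          (abs_add_le (g x) (t⁻¹ * (f x + (-1) * g x))) (hκpos x).le
        have a2 : |t⁻¹ * (f x + (-1) * g x)| * κ x ≤ 1 := by
          rw [abs_mul, abs_of_pos (inv_pos.2 h0), mul_assoc]
          have : f x + (-1) * g x = f x - g x := by ring
          rw [this]
          calc _ ≤ t⁻¹ * t := mul_le_mul_of_nonneg_left (hfg x) (inv_pos.2 h0).le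
            _ = 1 := inv_mul_cancel₀ h0.ne'
        have := hgR x
        linarith
      have h2 := hconv q g hqm hg t ht h1
      have e : (fun y => t * q y + (1 - t) * g y) = f := by
        funext y
        simp only [hq]
        field_simp
        ring
      rw [e] at h2
      have h3 := abs_le.1 (hC q hqm hqb)
      nlinarith
    · nlinarith

/-- tightness -/
lemma tight [CompleteSpace X] [TopologicalSpace.SeparableSpace X] {I : Type*}
    (hκc : Continuous κ) (hκpos : ∀ x, 0 < κ x)
    (φ : I → (X → ℝ) → ℝ)
    (hmono : ∀ i, ∀ f g, MemCk κ f → MemCk κ g → (∀ x, f x ≤ g x) → φ i f ≤ φ i g)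
    (hconv : ∀ i, ∀ f g, MemCk κ f → MemCk κ g → ∀ lam : ℝ, 0 ≤ lam → lam ≤ 1 →
        φ i (fun y => lam * f y + (1 - lam) * g y) ≤ lam * φ i f + (1 - lam) * φ i g)
    (hzero : ∀ i, φ i (fun _ => 0) = 0)
    (hbdd : ∀ r : ℝ, 0 ≤ r → ∃ C : ℝ, ∀ i, ∀ f, MemCk κ f → CkBound κ r f → |φ i f| ≤ C)
    (H : ∀ (fn : ℕ → X → ℝ), (∀ n, MemCk κ (fn n)) →
        (∀ x, Antitone fun n => fn n x) → (∀ x, Tendsto (fun n => fn n x) atTop (𝓝 (0:ℝ))) →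
        Tendsto (fun n => ⨆ i, φ i (fn n)) atTop (𝓝 (0:ℝ)))
    {ε M : ℝ} (hε : 0 < ε) (hM : 0 ≤ M) :
    ∃ K : Set X, IsCompact K ∧ ∀ i, ∀ f, MemCk κ f → (∀ x, 0 ≤ f x) → CkBound κ M f →
      (∀ x ∈ K, f x = 0) → φ i f ≤ ε := by
  rcases isEmpty_or_nonempty X with hX | hX
  · refine ⟨∅, isCompact_empty, fun i f _ _ _ _ => ?_⟩
    have : f = fun _ => 0 := by funext x; exact hX.elim x
    rw [this, hzero]; exact hε.le
  have hle : ∀ i f, MemCk κ f → φ i f ≤ ⨆ i, φ i f := by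
    intro i f hf
    obtain ⟨r, hr⟩ := hf.2
    obtain ⟨C, hC⟩ := hbdd |r| (abs_nonneg r)
    refine le_ciSup (f := fun i => φ i f) ⟨C, ?_⟩ i
    rintro _ ⟨j, rfl⟩
    exact (abs_le.1 (hC j f hf fun x => (hr x).trans (le_abs_self r))).2
  let s : ℕ → Set X := fun m => TopologicalSpace.denseSeq X '' Set.Iic m
  have hsne : ∀ m, (s m).Nonempty := fun m =>
    Set.Nonempty.image _ ⟨m, Set.mem_Iic.2 le_rfl⟩
  have hsfin : ∀ m, (s m).Finite := fun m => (Set.finite_Iic m).image _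
  let d : ℕ → X → ℝ := fun m x => Metric.infDist x (s m)
  have hdanti : ∀ x, Antitone fun m => d m x := by
    intro x a b hab
    exact Metric.infDist_le_infDist_of_subset
      (Set.image_mono (Set.Iic_subset_Iic.2 hab)) (hsne a)
  have hdsmall : ∀ x, ∀ δ > 0, ∃ m, d m x < δ := by
    intro x δ hδ
    obtain ⟨k, hk⟩ := (TopologicalSpace.denseRange_denseSeq X).exists_dist_lt x hδ
    have hmem : TopologicalSpace.denseSeq X k ∈ s k :=
      Set.mem_image_of_mem _ (Set.mem_Iic.2 le_rfl)
    exact ⟨k, (Metric.infDist_le_dist_of_mem hmem).trans_lt hk⟩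
  let w : ℕ → ℕ → X → ℝ := fun n m x =>
    M * (κ x)⁻¹ * min 1 (max 0 (((n:ℝ) + 1) * d m x - 1))
  have hwm : ∀ n m, MemCk κ (w n m) := by
    intro n m
    refine ⟨?_, M, fun x => ?_⟩
    · have h1 : Continuous fun x => (κ x)⁻¹ := hκc.inv₀ fun x => (hκpos x).ne'
      have h2 : Continuous (d m) := Metric.continuous_infDist_pt _
      fun_prop
    · have h0 : 0 ≤ min 1 (max 0 (((n:ℝ) + 1) * d m x - 1)) :=
        le_min zero_le_one (le_max_left _ _)
      have h1 : 0 ≤ M * (κ x)⁻¹ := mul_nonneg hM (inv_pos.2 (hκpos x)).le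
      rw [abs_of_nonneg (mul_nonneg h1 h0)]
      have h2 : min 1 (max 0 (((n:ℝ) + 1) * d m x - 1)) ≤ 1 := min_le_left _ _
      calc _ = M * ((κ x)⁻¹ * κ x) * min 1 (max 0 (((n:ℝ) + 1) * d m x - 1)) := by
            ring
        _ = M * min 1 (max 0 (((n:ℝ) + 1) * d m x - 1)) := by
            rw [inv_mul_cancel₀ (hκpos x).ne', mul_one]
        _ ≤ M := mul_le_of_le_one_right hM h2
  have hw0 : ∀ n m x, 0 ≤ w n m x := fun n m x =>
    mul_nonneg (mul_nonneg hM (inv_pos.2 (hκpos x)).le) (le_min zero_le_one (le_max_left _ _))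
  have hex : ∀ n : ℕ, ∃ m, (⨆ i, φ i (fun x => 2 ^ (n + 1) * (2 * w n m x))) < ε := by
    intro n
    have hT := H (fun m x => 2 ^ (n + 1) * (2 * w n m x))
      (fun m => ((hwm n m).cmul 2).cmul _) ?_ ?_
    · exact (hT.eventually_lt_const hε).exists
    · intro x a b hab
      have := hdanti x hab
      have h1 : 0 ≤ M * (κ x)⁻¹ := mul_nonneg hM (inv_pos.2 (hκpos x)).le
      simp only [w]
      gcongr
    · intro x
      obtain ⟨m₀, hm₀⟩ := hdsmall x (1 / ((n:ℝ) + 1)) (by positivity)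
      refine tendsto_const_nhds.congr' ?_
      filter_upwards [eventually_ge_atTop m₀] with m hm
      have h1 : d m x < 1 / ((n:ℝ) + 1) := (hdanti x hm).trans_lt hm₀
      have h2 : ((n:ℝ) + 1) * d m x - 1 ≤ 0 := by
        rw [lt_div_iff₀ (by positivity)] at h1
        linarith
      simp [w, max_eq_left h2]
  choose m hm using hex
  refine ⟨⋂ n : ℕ, {x | d (m n) x ≤ 2 / ((n:ℝ) + 1)}, ?_, ?_⟩
  · refine TotallyBounded.isCompact_of_isClosed ?_ ?_
    · rw [Metric.totallyBounded_iff]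
      intro δ hδ
      obtain ⟨n, hn⟩ := exists_nat_gt (2 / δ)
      refine ⟨s (m n), hsfin _, fun x hx => ?_⟩
      have h1 : d (m n) x ≤ 2 / ((n:ℝ) + 1) := Set.mem_iInter.1 hx n
      have h2 : 2 / ((n:ℝ) + 1) < δ := by
        rw [div_lt_iff₀ hδ] at hn
        rw [div_lt_iff₀ (by positivity)]
        nlinarith
      obtain ⟨y, hy, hxy⟩ := (Metric.infDist_lt_iff (hsne _)).1 (h1.trans_lt h2)
      exact Set.mem_biUnion hy hxy
    · exact isClosed_iInter fun n =>
        isClosed_le (Metric.continuous_infDist_pt _) continuous_const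
  · intro i f hf hf0 hfM hfK
    let u : ℕ → X → ℝ := fun n x => w n (m n) x
    have hu : ∀ n, MemCk κ (u n) := fun n => hwm _ _
    have hS := sum_bound hκpos (φ i) (hconv i) (hzero i) (u := fun n x => 2 * u n x)
      (fun n => (hu n).cmul 2) hε.le
      (fun n => (hle i _ (((hu n).cmul 2).cmul _)).trans (hm n).le)
    let S : ℕ → X → ℝ := fun N x => ∑ j ∈ Finset.range N, u (0 + j) x
    have hSm : ∀ N, MemCk κ (S N) := fun N => MemCk.sum hκpos hu N 0
    have hSmono : ∀ x, Monotone fun N => S N x := by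
      intro x a b hab
      exact Finset.sum_le_sum_of_subset_of_nonneg (Finset.range_mono hab)
        (fun j _ _ => hw0 _ _ _)
    let h : ℕ → X → ℝ := fun N x => 2 * max (f x + (-1) * S N x) 0
    have hhm : ∀ N, MemCk κ (h N) := fun N =>
      ((hf.add' hκpos ((hSm N).cmul (-1))).pos hκpos).cmul 2
    have hT := H h hhm ?_ ?_
    · have hN : ∀ N, φ i f ≤ 1/2 * ε + 1/2 * ⨆ i, φ i (h N) := by
        intro N
        have h1 := hconv i (fun x => 2 * S N x) (h N) ((hSm N).cmul 2) (hhm N) (1/2)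
          (by norm_num) (by norm_num)
        have h2 : φ i (fun x => 2 * S N x) ≤ ε := by
          have := hS N 0
          simp only [pow_zero, one_mul, ← Finset.mul_sum] at this
          exact this
        have h3 := hle i _ (hhm N)
        have h4 := hmono i f _ hf
          ((((hSm N).cmul 2).cmul (1/2)).add' hκpos ((hhm N).cmul (1 - 1/2))) (by
            intro x
            have := le_max_left (f x + (-1) * S N x) 0
            simp only [h]
            linarith)
        linarith
      have := ge_of_tendsto' ((hT.const_mul (1/2)).const_add (1/2 * ε)) hN
      linarith
    · intro x a b hab
      have := hSmono x hab
      simp only [h]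
      simp only at this
      have : f x + (-1) * S b x ≤ f x + (-1) * S a x := by linarith
      gcongr
    · intro x
      have key : ∃ N, f x ≤ S N x := by
        by_cases hx : x ∈ ⋂ n : ℕ, {x | d (m n) x ≤ 2 / ((n:ℝ) + 1)}
        · exact ⟨0, by simp [S, hfK x hx]⟩
        · simp only [Set.mem_iInter, not_forall, Set.mem_setOf_eq, not_le] at hx
          obtain ⟨n, hn⟩ := hx
          refine ⟨n + 1, ?_⟩
          have h1 : u n x = M * (κ x)⁻¹ := by
            rw [div_lt_iff₀ (by positivity)] at hn
            have h2 : 1 ≤ max 0 (((n:ℝ) + 1) * d (m n) x - 1) :=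
              le_trans (by linarith) (le_max_right _ _)
            simp only [u, w, min_eq_left h2, mul_one]
          have h2 : f x ≤ u n x := by
            rw [h1, ← div_eq_mul_inv, le_div_iff₀ (hκpos x)]
            have := hfM x
            rwa [abs_of_nonneg (hf0 x)] at this
          refine h2.trans ?_
          have := Finset.single_le_sum (f := fun j => u (0 + j) x) (s := Finset.range (n+1))
            (fun j _ => hw0 _ _ _) (Finset.mem_range.2 (Nat.lt_succ_self n))
          simpa [S] using this
      obtain ⟨N₀, hN₀⟩ := key
      refine tendsto_const_nhds.congr' ?_
      filter_upwards [eventually_ge_atTop N₀] with N hN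
      have h1 := hSmono x hN
      simp only at h1
      simp only [h]
      rw [max_eq_right (by linarith), mul_zero]

end helpers

/-- equivalence of continuity from above at `0` (uniformly in `i`) and
the uniform compact-continuity estimate. -/
theorem stmt6
    {X : Type*} [MetricSpace X] [CompleteSpace X] [TopologicalSpace.SeparableSpace X]
    {I : Type*}
    (κ : X → ℝ) (hκc : Continuous κ) (hκpos : ∀ x, 0 < κ x) (hκbd : ∃ C, ∀ x, κ x ≤ C)
    (φ : I → (X → ℝ) → ℝ)
    (hmono : ∀ i, ∀ f g, MemCk κ f → MemCk κ g → (∀ x, f x ≤ g x) → φ i f ≤ φ i g)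
    (hconv : ∀ i, ∀ f g, MemCk κ f → MemCk κ g → ∀ lam : ℝ, 0 ≤ lam → lam ≤ 1 →
        φ i (fun y => lam * f y + (1 - lam) * g y) ≤ lam * φ i f + (1 - lam) * φ i g)
    (hzero : ∀ i, φ i (fun _ => 0) = 0)
    (hbdd : ∀ r : ℝ, 0 ≤ r → ∃ C : ℝ, ∀ i, ∀ f, MemCk κ f → CkBound κ r f → |φ i f| ≤ C) :
    ((∀ (fn : ℕ → X → ℝ), (∀ n, MemCk κ (fn n)) →
        (∀ x, Antitone fun n => fn n x) → (∀ x, Tendsto (fun n => fn n x) atTop (𝓝 (0:ℝ))) →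
        Tendsto (fun n => ⨆ i, φ i (fn n)) atTop (𝓝 (0:ℝ)))
      ↔
      (∀ ε > (0:ℝ), ∀ r : ℝ, 0 ≤ r → ∃ c ≥ (0:ℝ), ∃ K : Set X, IsCompact K ∧
        ∀ i, ∀ f g, MemCk κ f → MemCk κ g → CkBound κ r f → CkBound κ r g →
          |φ i f - φ i g| ≤ c * (⨆ x : K, |f (x : X) - g (x : X)|) + ε)) := by
  obtain ⟨C₀, hC₀⟩ := hκbd
  constructor
  · intro H ε hε r hr
    set B := max C₀ 1 with hB
    have hB1 : 1 ≤ B := le_max_right _ _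
    have hκB : ∀ x, κ x ≤ B := fun x => (hC₀ x).trans (le_max_left _ _)
    obtain ⟨Cr', hCr'⟩ := hbdd r hr
    obtain ⟨L', hL'⟩ := hbdd (2 * (r + 1) + 1) (by linarith)
    set Cr := |Cr'|
    set L := |L'|
    have hCr : ∀ i, ∀ f, MemCk κ f → CkBound κ r f → |φ i f| ≤ Cr :=
      fun i f h1 h2 => (hCr' i f h1 h2).trans (le_abs_self _)
    have hL : ∀ i, ∀ f, MemCk κ f → CkBound κ (2 * (r + 1) + 1) f → |φ i f| ≤ L :=
      fun i f h1 h2 => (hL' i f h1 h2).trans (le_abs_self _)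
    have hCr0 : 0 ≤ Cr := abs_nonneg _
    have hL0 : 0 ≤ L := abs_nonneg _
    set D := 4 * L * r + Cr + 1 with hD
    have hD0 : 0 < D := by positivity
    set s := min (1/2) (ε / (2 * D)) with hs
    have hs0 : 0 < s := lt_min (by norm_num) (by positivity)
    have hs2 : s ≤ 1/2 := min_le_left _ _
    have hsD : s * D ≤ ε / 2 := by
      calc s * D ≤ ε / (2 * D) * D := by gcongr; exact min_le_right _ _
        _ = ε / 2 := by field_simp
    obtain ⟨K, hK, hKt⟩ := tight hκc hκpos φ hmono hconv hzero hbdd H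
      (ε := ε / 2) (M := s⁻¹ * (2 * r)) (by linarith) (by positivity)
    refine ⟨4 * L * B + 2 * Cr * B, by positivity, K, hK, ?_⟩
    have main : ∀ i, ∀ f g, MemCk κ f → MemCk κ g → CkBound κ r f → CkBound κ r g →
          φ i f - φ i g ≤ (4 * L * B + 2 * Cr * B) * (⨆ x : K, |f (x : X) - g (x : X)|) + ε := by
      intro i f g hf hg hfr hgr
      set δ := ⨆ x : K, |f (x : X) - g (x : X)| with hδ
      have hδ0 : 0 ≤ δ := Real.iSup_nonneg fun x => abs_nonneg _
      have hδK : ∀ x ∈ K, |f x - g x| ≤ δ := by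
        intro x hx
        have hb : BddAbove (Set.range fun x : K => |f (x : X) - g (x : X)|) := by
          have := (hK.image (f := fun x => |f x - g x|) (hf.1.sub hg.1).abs).bddAbove
          rwa [Set.image_eq_range] at this
        exact le_ciSup hb ⟨x, hx⟩
      have hfC := abs_le.1 (hCr i f hf hfr)
      have hgC := abs_le.1 (hCr i g hg hgr)
      have hLBδ : 0 ≤ L * B * δ := by positivity
      rcases le_total 1 (B * δ) with h1 | h1
      · nlinarith
      · set v : X → ℝ := fun x => max ((f x + (-1) * g x) + (-δ)) 0 with hv
        have hδm : ∀ a : ℝ, MemCk κ (fun _ => a) := MemCk.const hκpos hC₀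
        have hvm : MemCk κ v :=
          ((hf.add' hκpos (hg.cmul (-1))).add' hκpos (hδm _)).pos hκpos
        have hvb : CkBound κ (2 * r) v := by
          intro x
          have hv0 : 0 ≤ v x := le_max_right _ _
          have hv1 : v x ≤ |f x| + |g x| := by
            refine max_le ?_ (by positivity)
            have := le_abs_self (f x)
            have := neg_abs_le (g x)
            linarith
          rw [abs_of_nonneg hv0]
          have := mul_le_mul_of_nonneg_right hv1 (hκpos x).le
          have := hfr x
          have := hgr x
          linarith
        have hφv : φ i (fun x => s⁻¹ * v x) ≤ ε / 2 := by
          refine hKt i _ (hvm.cmul _)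
            (fun x => mul_nonneg (inv_pos.2 hs0).le (le_max_right _ _)) ?_ ?_
          · intro x
            rw [abs_mul, abs_of_pos (inv_pos.2 hs0), mul_assoc]
            exact mul_le_mul_of_nonneg_left (hvb x) (inv_pos.2 hs0).le
          · intro x hx
            have h2 := (abs_le.1 (hδK x hx)).2
            have : v x = 0 := max_eq_right (by linarith)
            rw [this, mul_zero]
        set p := (1 - s)⁻¹ with hp
        have h1s : 0 < 1 - s := by linarith
        have hp0 : 0 < p := inv_pos.2 h1s
        have hp2 : p ≤ 2 := by
          rw [hp, inv_le_comm₀ h1s (by norm_num)]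
          linarith
        have hps : (1 - s) * p = 1 := mul_inv_cancel₀ h1s.ne'
        set a : X → ℝ := fun x => p * (g x + δ) with ha
        have ham : MemCk κ a := (hg.add' hκpos (hδm δ)).cmul p
        have hδκ : ∀ x, δ * κ x ≤ B * δ := fun x => by
          have := mul_le_mul_of_nonneg_left (hκB x) hδ0
          linarith
        have hab : CkBound κ (2 * (r + 1)) a := by
          intro x
          have h2 := mul_le_mul_of_nonneg_right (abs_add_le (g x) δ) (hκpos x).le
          rw [abs_of_nonneg hδ0] at h2
          have h3 := hδκ x
          have h4 := hgr x
          simp only [ha]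
          rw [abs_mul, abs_of_pos hp0, mul_assoc]
          have h5 : |g x + δ| * κ x ≤ r + 1 := by linarith
          have h6 : 0 ≤ |g x + δ| * κ x := mul_nonneg (abs_nonneg _) (hκpos x).le
          nlinarith
        have hag : ∀ x, |a x - g x| * κ x ≤ 2 * (B * δ + s * r) := by
          intro x
          have e : a x - g x = p * (δ + s * g x) := by
            simp only [ha]
            linear_combination (g x) * hps
          have h2 := mul_le_mul_of_nonneg_right (abs_add_le δ (s * g x)) (hκpos x).le
          rw [abs_of_nonneg hδ0, abs_mul s, abs_of_pos hs0] at h2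
          have h3 := hδκ x
          have h4 := mul_le_mul_of_nonneg_left (hgr x) hs0.le
          rw [e, abs_mul, abs_of_pos hp0, mul_assoc]
          have h5 : |δ + s * g x| * κ x ≤ B * δ + s * r := by linarith
          have h6 : 0 ≤ |δ + s * g x| * κ x := mul_nonneg (abs_nonneg _) (hκpos x).le
          nlinarith
        have hlip := lip_bound hκpos (φ i) (hconv i) (hL i) ham hg hab
          (fun x => (hgr x).trans (by linarith)) (t := 2 * (B * δ + s * r)) (by positivity) hag
        have hc := hconv i (fun x => s⁻¹ * v x) a (hvm.cmul _) ham s hs0.le (by linarith)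
        have hm := hmono i f _ hf (((hvm.cmul s⁻¹).cmul s).add' hκpos (ham.cmul (1 - s))) (by
          intro x
          have h2 : s * (s⁻¹ * v x) = v x := by
            rw [← mul_assoc, mul_inv_cancel₀ hs0.ne', one_mul]
          have h3 : (1 - s) * a x = g x + δ := by
            simp only [ha]
            rw [← mul_assoc, hps, one_mul]
          rw [h2, h3]
          have := le_max_left ((f x + (-1) * g x) + (-δ)) 0
          simp only [hv]
          linarith)
        have q1 : s * φ i (fun x => s⁻¹ * v x) ≤ ε / 2 := by nlinarith
        have q2 : (1 - s) * (φ i a - φ i g) ≤ 2 * L * (2 * (B * δ + s * r)) := by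
          have q0 : 0 ≤ 2 * L * (2 * (B * δ + s * r)) := by positivity
          nlinarith
        have q3 : -(s * φ i g) ≤ s * Cr := by nlinarith
        have q4 : 0 ≤ Cr * B * δ := by positivity
        have q5 : s * (4 * L * r + Cr + 1) ≤ ε / 2 := hsD
        nlinarith
    intro i f g hf hg hfr hgr
    have m1 := main i f g hf hg hfr hgr
    have m2 := main i g f hg hf hgr hfr
    have e : (⨆ x : K, |g (x : X) - f (x : X)|) = ⨆ x : K, |f (x : X) - g (x : X)| := by
      simp only [abs_sub_comm]
    rw [e] at m2
    exact abs_le.2 ⟨by linarith, m1⟩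
  · intro H fn hfn hanti hlim
    have hnn : ∀ n x, 0 ≤ fn n x := fun n x => (hanti x).le_of_tendsto (hlim x) n
    have hφ0 : ∀ n i, 0 ≤ φ i (fn n) := fun n i => by
      rw [← hzero i]
      exact hmono i _ _ MemCk.zero' (hfn n) (hnn n)
    obtain ⟨r', hr'⟩ := (hfn 0).2
    set r := |r'|
    have hr : ∀ n, CkBound κ r (fn n) := by
      intro n x
      refine le_trans ?_ ((hr' x).trans (le_abs_self _))
      refine mul_le_mul_of_nonneg_right ?_ (hκpos x).le
      rw [abs_of_nonneg (hnn n x), abs_of_nonneg (hnn 0 x)]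
      exact hanti x (Nat.zero_le n)
    rw [Metric.tendsto_atTop]
    intro ε hε
    obtain ⟨c, hc, K, hK, hcK⟩ := H (ε / 4) (by linarith) r (abs_nonneg _)
    have hdini : TendstoUniformlyOn fn (fun _ => (0:ℝ)) atTop K :=
      Antitone.tendstoUniformlyOn_of_forall_tendsto hK (fun n => (hfn n).1.continuousOn)
        (fun x _ => hanti x) continuousOn_const (fun x _ => hlim x)
    rw [Metric.tendstoUniformlyOn_iff] at hdini
    obtain ⟨N, hN⟩ := eventually_atTop.1 (hdini (ε / (4 * (c + 1))) (by positivity))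
    refine ⟨N, fun n hn => ?_⟩
    have hsup : (⨆ x : K, |fn n (x : X) - (fun _ => (0:ℝ)) (x : X)|) ≤ ε / (4 * (c + 1)) := by
      refine Real.iSup_le (fun x => ?_) (by positivity)
      have := hN n hn x x.2
      rw [dist_comm, Real.dist_eq] at this
      exact this.le
    have hi : ∀ i, φ i (fn n) ≤ ε / 2 := by
      intro i
      have h1 := hcK i (fn n) (fun _ => 0) (hfn n) MemCk.zero' (hr n)
        (fun x => by simp [r])
      rw [hzero, sub_zero] at h1
      have h2 := (le_abs_self _).trans h1
      have h3 : c * (ε / (4 * (c + 1))) ≤ ε / 4 := by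
        rw [mul_div_assoc', div_le_div_iff₀ (by positivity) (by norm_num)]
        nlinarith
      have h4 := mul_le_mul_of_nonneg_left hsup hc
      linarith
    have h5 : (⨆ i, φ i (fn n)) ≤ ε / 2 := Real.iSup_le hi (by linarith)
    have h6 : 0 ≤ ⨆ i, φ i (fn n) := Real.iSup_nonneg (hφ0 n)
    rw [Real.dist_eq, sub_zero, abs_of_nonneg h6]
    linarith
end

section
/- Let (S(t))_{t≥0} satisfy Assumption S. Let (f_n) ⊂ U_κ be bounded above, (t_n) ⊂ [0,∞) a convergent sequence, f := Γ-limsup_{n→∞} f_n and t := lim_n t_n. Then Γ-limsup_{n→∞} S(t_n)f_n ≤ S(t)f pointwise. -/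
open Filter MeasureTheory Topology
open scoped ENNReal Topology

/-- usc envelope of the tail supremum -/
noncomputable def tailEnv {X : Type*} [MetricSpace X] (fn : ℕ → X → EReal) (k : ℕ) (x : X) : EReal :=
  ⨅ (U : Set X) (_ : U ∈ 𝓝 x), ⨆ (n : ℕ) (_ : k ≤ n) (y : X) (_ : y ∈ U), fn n y

theorem tailEnv_usc {X : Type*} [MetricSpace X] (fn : ℕ → X → EReal) (k : ℕ) :
    UpperSemicontinuous (tailEnv fn k) := by
  intro x c hc
  simp only [tailEnv, iInf_lt_iff] at hc
  obtain ⟨U, hU, hlt⟩ := hc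
  filter_upwards [eventually_mem_nhds_iff.2 hU] with z hz
  exact lt_of_le_of_lt (iInf₂_le U hz) hlt

theorem le_tailEnv {X : Type*} [MetricSpace X] (fn : ℕ → X → EReal) (k n : ℕ) (h : k ≤ n) (x : X) :
    fn n x ≤ tailEnv fn k x :=
  le_iInf₂ fun U hU => le_iSup₂_of_le n h <| le_iSup₂_of_le x (mem_of_mem_nhds hU) le_rfl

theorem tailEnv_anti {X : Type*} [MetricSpace X] (fn : ℕ → X → EReal) (x : X) :
    Antitone fun k => tailEnv fn k x := by
  intro k l hkl
  refine le_iInf₂ fun U hU => (iInf₂_le U hU).trans ?_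
  exact iSup₂_le fun n hn => le_iSup₂_of_le n (hkl.trans hn) le_rfl

theorem gammaLimsup_le_tailEnv {X : Type*} [MetricSpace X] (fn : ℕ → X → EReal) (k : ℕ) (x : X) :
    gammaLimsup fn x ≤ tailEnv fn k x := by
  refine iSup₂_le fun u hu => le_iInf₂ fun U hU => ?_
  refine limsup_le_of_le (by isBoundedDefault) ?_
  filter_upwards [hu hU, eventually_ge_atTop k] with n hn hk
  exact le_iSup₂_of_le n hk <| le_iSup₂_of_le (u n) hn le_rfl

theorem iInf_tailEnv {X : Type*} [MetricSpace X] (fn : ℕ → X → EReal) (x : X) :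
    ⨅ k, tailEnv fn k x = gammaLimsup fn x := by
  refine le_antisymm ?_ (le_iInf fun k => gammaLimsup_le_tailEnv fn k x)
  refine le_of_forall_lt fun a ha => ?_
  obtain ⟨b, hab, hb⟩ := exists_between ha
  refine lt_of_lt_of_le hab ?_
  have key : ∀ k m : ℕ, ∃ n, k ≤ n ∧ ∃ y ∈ Metric.ball x (1 / ((m : ℝ) + 1)), b < fn n y := by
    intro k m
    have h1 : b < ⨆ (n : ℕ) (_ : k ≤ n) (y : X) (_ : y ∈ Metric.ball x (1 / ((m : ℝ) + 1))), fn n y :=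
      lt_of_lt_of_le hb ((iInf_le _ k).trans
        (iInf₂_le _ (Metric.ball_mem_nhds x Nat.one_div_pos_of_nat)))
    simp only [lt_iSup_iff] at h1
    obtain ⟨n, hn, y, hy, h⟩ := h1
    exact ⟨n, hn, y, hy, h⟩
  have key2 : ∀ m : ℕ, ∃ᶠ n in atTop,
      ∃ y ∈ Metric.ball x (1 / ((m : ℝ) + 1)), b < fn n y := by
    intro m
    rw [frequently_atTop]
    intro k
    obtain ⟨n, hn, h⟩ := key k m
    exact ⟨n, hn, h⟩
  obtain ⟨φ, hφ, hφP⟩ := extraction_forall_of_frequently key2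
  choose y hy hby using hφP
  classical
  let u : ℕ → X := fun n => if h : ∃ m, φ m = n then y h.choose else x
  have hu : ∀ m, u (φ m) = y m := by
    intro m
    have h : ∃ m', φ m' = φ m := ⟨m, rfl⟩
    have : h.choose = m := hφ.injective h.choose_spec
    simp only [u, dif_pos h, this]
  have hut : Tendsto u atTop (𝓝 x) := by
    rw [Metric.tendsto_atTop]
    intro ε hε
    obtain ⟨M, hM⟩ := exists_nat_one_div_lt hε
    refine ⟨φ M, fun n hn => ?_⟩
    by_cases h : ∃ m, φ m = n
    · obtain ⟨m, rfl⟩ := h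
      rw [hu]
      have hMm : M ≤ m := hφ.le_iff_le.1 hn
      exact lt_trans (lt_of_lt_of_le (hy m) (Nat.one_div_le_one_div hMm)) hM
    · simp only [u, dif_neg h, dist_self]; exact hε
  refine le_trans ?_ (le_iSup₂ (f := fun (u : ℕ → X) (_ : Tendsto u atTop (𝓝 x)) =>
    Filter.limsup (fun n => fn n (u n)) atTop) u hut)
  refine le_limsup_of_frequently_le ?_ (by isBoundedDefault)
  rw [frequently_atTop]
  intro k
  exact ⟨φ k, hφ.id_le k, by rw [hu]; exact (hby k).le⟩

theorem le_div_of_bd {X : Type*} [MetricSpace X] {κ : X → ℝ} (hκpos : ∀ x, 0 < κ x)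
    {f : X → EReal} {r : ℝ} {x : X} 
    (h : max (f x) 0 * (κ x : EReal) ≤ (r : EReal)) : f x ≤ ((r / κ x : ℝ) : EReal) := by
  have h1 : max (f x) 0 ≤ ((r / κ x : ℝ) : EReal) := by
    rw [EReal.coe_div]
    exact (EReal.le_div_iff_mul_le (by exact_mod_cast hκpos x) (EReal.coe_ne_top _)).2 h
  exact (le_max_left _ _).trans h1

theorem memUk_of_le {X : Type*} [MetricSpace X] {κ : X → ℝ} (hκpos : ∀ x, 0 < κ x)
    {f : X → EReal} {r : ℝ} (hr : 0 ≤ r) (hf : UpperSemicontinuous f)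
    (h : ∀ x, f x ≤ ((r / κ x : ℝ) : EReal)) : MemUk κ f := by
  refine ⟨hf, fun x => lt_of_le_of_lt (h x) (EReal.coe_lt_top _), r, fun x => ?_⟩
  refine (EReal.le_div_iff_mul_le (by exact_mod_cast hκpos x) (EReal.coe_ne_top _)).1 ?_
  rw [← EReal.coe_div]
  exact max_le (h x) (by exact_mod_cast div_nonneg hr (hκpos x).le)

theorem tailEnv_le {X : Type*} [MetricSpace X] {κ : X → ℝ} (hκc : Continuous κ)
    (hκpos : ∀ x, 0 < κ x) {fn : ℕ → X → EReal} {r : ℝ}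
    (h : ∀ n x, fn n x ≤ ((r / κ x : ℝ) : EReal)) (k : ℕ) (x : X) :
    tailEnv fn k x ≤ ((r / κ x : ℝ) : EReal) := by
  refine le_of_forall_gt_imp_ge_of_dense fun c hc => ?_
  have hcont : Continuous fun y => ((r / κ y : ℝ) : EReal) :=
    continuous_coe_real_ereal.comp (continuous_const.div hκc fun y => (hκpos y).ne')
  have hU : {y | ((r / κ y : ℝ) : EReal) < c} ∈ 𝓝 x :=
    hcont.continuousAt.eventually_lt_const hc
  refine (iInf₂_le _ hU).trans ?_
  exact iSup₂_le fun n _ => iSup₂_le fun y hy => (h n y).trans (le_of_lt hy)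

/-- `Γ`-upper semicontinuity of `(t,f) ↦ S(t)f`. -/
theorem stmt8
    {X : Type*} [MetricSpace X] [CompleteSpace X] [TopologicalSpace.SeparableSpace X]
    (κ : X → ℝ) (hκc : Continuous κ) (hκpos : ∀ x, 0 < κ x) (hκbd : ∃ C, ∀ x, κ x ≤ C)
    (S : ℝ → (X → EReal) → (X → EReal)) (hS : AssumptionS κ S)
    (fn : ℕ → X → EReal) (hfn : ∀ n, MemUk κ (fn n))
    (hbd : ∃ r : ℝ, ∀ n x, max (fn n x) 0 * (κ x : EReal) ≤ (r : EReal))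
    (t : ℕ → ℝ) (ht0 : ∀ n, 0 ≤ t n) (T : ℝ) (hT : Tendsto t atTop (𝓝 T)) :
    ∀ x, gammaLimsup (fun n => S (t n) (fn n)) x ≤ S T (gammaLimsup fn) x := by
  intro x
  obtain ⟨r, hr⟩ := hbd
  have hr0 : 0 ≤ r := by
    have h1 : (0 : EReal) ≤ max (fn 0 x) 0 * (κ x : EReal) :=
      mul_nonneg (le_max_right _ _) (by exact_mod_cast (hκpos x).le)
    exact_mod_cast h1.trans (hr 0 x)
  have hT0 : 0 ≤ T := ge_of_tendsto' hT ht0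
  have hle : ∀ n x, fn n x ≤ ((r / κ x : ℝ) : EReal) := fun n x => le_div_of_bd hκpos (hr n x)
  have hg : ∀ k, MemUk κ (tailEnv fn k) := fun k =>
    memUk_of_le hκpos hr0 (tailEnv_usc fn k) (tailEnv_le hκc hκpos hle k)
  have hf : MemUk κ (gammaLimsup fn) := by
    refine memUk_of_le hκpos hr0 ?_ fun y =>
      (gammaLimsup_le_tailEnv fn 0 y).trans (tailEnv_le hκc hκpos hle 0 y)
    have : gammaLimsup fn = fun y => ⨅ k, tailEnv fn k y := funext fun y => (iInf_tailEnv fn y).symm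
    rw [this]
    exact upperSemicontinuous_iInf fun k => tailEnv_usc fn k
  rw [← hS.contAbove T hT0 (tailEnv fn) (gammaLimsup fn) hg hf (tailEnv_anti fn)
    (iInf_tailEnv fn) x]
  refine le_iInf fun k => ?_
  refine le_trans ?_ (hS.gammaUsc T hT0 _ (hg k) x)
  refine le_trans ?_ (le_iSup_of_le t (le_iSup₂_of_le ht0 hT le_rfl))
  refine iSup₂_mono fun u hu => ?_
  refine limsup_le_limsup ?_ (by isBoundedDefault) (by isBoundedDefault)
  filter_upwards [eventually_ge_atTop k] with n hn
  exact hS.monotone (t n) (ht0 n) _ _ (hfn n) (hg k) (le_tailEnv fn k n hn) (u n)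
end

section
/- Let (S(t))_{t≥0} satisfy Assumption S. Then for every ε > 0, r, T ≥ 0 and compact K ⊂ X there exist a compact K' ⊂ X and c ≥ 0 such that sup_{x∈K} |(S(t)f)(x) − (S(t)g)(x)| ≤ c·sup_{x∈K'}|f(x) − g(x)| + ε for all t ∈ [0,T] and f, g ∈ B_{C_κ}(r). In particular, if (f_n) ⊂ C_κ with sup_n ‖f_n‖_κ < ∞ and f_n → f ∈ C_κ uniformly on compact sets, then S(t)f_n → S(t)f uniformly on compact sets, for every t ≥ 0. -/
open Filter MeasureTheory Topology
open scoped ENNReal Topology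

section helpers

variable {X : Type*} [MetricSpace X]

/-- two-level function: `R/κ` on `F`, `r/κ` off `F` -/
noncomputable def twoLevel (κ : X → ℝ) (r R : ℝ) (F : Set X) : X → EReal :=
  open Classical in fun x => (((if x ∈ F then R else r) / κ x : ℝ) : EReal)

lemma memUk_ecoe {κ : X → ℝ} (hκpos : ∀ x, 0 < κ x) {f : X → ℝ} (hf : MemCk κ f) :
    MemUk κ (ecoe f) := by
  obtain ⟨hc, r, hr⟩ := hf
  refine ⟨?_, fun x => EReal.coe_lt_top _, r, fun x => ?_⟩
  · exact (continuous_coe_real_ereal.comp hc).upperSemicontinuous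
  · have h1 : max (f x) 0 * κ x ≤ r := by
      refine le_trans ?_ (hr x)
      exact mul_le_mul_of_nonneg_right (max_le (le_abs_self _) (abs_nonneg _)) (hκpos x).le
    have h2 : max (ecoe f x) 0 * (κ x : EReal) = ((max (f x) 0 * κ x : ℝ) : EReal) := by
      rw [EReal.coe_mul]; congr 1
    rw [h2]; exact_mod_cast h1

lemma memUk_twoLevel {κ : X → ℝ} (hκc : Continuous κ) (hκpos : ∀ x, 0 < κ x)
    {r R : ℝ} (hr : 0 ≤ r) (hrR : r ≤ R) {F : Set X} (hF : IsClosed F) :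
    MemUk κ (twoLevel κ r R F) := by
  classical
  have hcR : ∀ a : ℝ, Continuous fun x => ((a / κ x : ℝ) : EReal) := fun a =>
    continuous_coe_real_ereal.comp (continuous_const.div hκc fun x => (hκpos x).ne')
  refine ⟨?_, fun x => EReal.coe_lt_top _, R, fun x => ?_⟩
  · intro x y hy
    by_cases hx : x ∈ F
    · have h1 : ((R / κ x : ℝ) : EReal) < y := by simpa [twoLevel, hx] using hy
      have h2 := (hcR R).continuousAt.eventually (eventually_lt_nhds h1)
      filter_upwards [h2] with z hz
      refine lt_of_le_of_lt ?_ hz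
      simp only [twoLevel]
      apply EReal.coe_le_coe_iff.2
      apply div_le_div_of_nonneg_right _ (hκpos z).le
      split_ifs <;> linarith
    · have h1 : ((r / κ x : ℝ) : EReal) < y := by simpa [twoLevel, hx] using hy
      have h2 := (hcR r).continuousAt.eventually (eventually_lt_nhds h1)
      filter_upwards [h2, hF.isOpen_compl.mem_nhds hx] with z hz hz2
      have hz3 : z ∉ F := hz2
      simpa [twoLevel, hz3] using hz
  · have h2 : max (twoLevel κ r R F x) 0 * (κ x : EReal)
        = ((max ((if x ∈ F then R else r) / κ x) 0 * κ x : ℝ) : EReal) := by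
      rw [EReal.coe_mul]; congr 1
    rw [h2]
    apply EReal.coe_le_coe_iff.2
    rw [max_eq_left, div_mul_cancel₀ _ (hκpos x).ne']
    · split_ifs <;> linarith
    · apply div_nonneg _ (hκpos x).le
      split_ifs <;> linarith

/-- uniform real bound -/
lemma real_bound {κ : X → ℝ} (hκc : Continuous κ) (hκpos : ∀ x, 0 < κ x)
    {S : ℝ → (X → EReal) → (X → EReal)} (hS : AssumptionS κ S) {r T : ℝ} (hr : 0 ≤ r)
    (hT : 0 ≤ T) {K : Set X} (hK : IsCompact K) :
    ∃ M : ℝ, 0 ≤ M ∧ ∀ t, 0 ≤ t → t ≤ T → ∀ f : X → ℝ, MemCk κ f → CkBound κ r f →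
      ∀ x ∈ K, ∃ v : ℝ, S t (ecoe f) x = (v : EReal) ∧ |v| ≤ M := by
  obtain ⟨C, hC, hb⟩ := hS.bounded r T hr hT
  obtain ⟨B, hB⟩ : ∃ B : ℝ, ∀ x ∈ K, (κ x)⁻¹ ≤ B := by
    obtain ⟨B, hB⟩ := hK.bddAbove_image (f := fun x => (κ x)⁻¹)
      ((hκc.inv₀ fun x => (hκpos x).ne').continuousOn)
    exact ⟨B, fun x hx => hB (Set.mem_image_of_mem _ hx)⟩
  refine ⟨C.toReal * max B 0, by positivity, fun t ht htT f hf hfr x hx => ?_⟩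
  have h1 : (S t (ecoe f) x).abs * ENNReal.ofReal (κ x) ≤ C :=
    (le_iSup (fun x => (S t (ecoe f) x).abs * ENNReal.ofReal (κ x)) x).trans
      (hb t ht htT f hf hfr)
  have hk : ENNReal.ofReal (κ x) ≠ 0 := by simpa using hκpos x
  generalize S t (ecoe f) x = w at h1
  induction w with
  | bot => rw [EReal.abs_bot, ENNReal.top_mul hk] at h1; exact absurd (top_le_iff.1 h1) hC
  | top => rw [EReal.abs_top, ENNReal.top_mul hk] at h1; exact absurd (top_le_iff.1 h1) hC
  | coe v =>
    refine ⟨v, rfl, ?_⟩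
    rw [EReal.abs_def, ← ENNReal.ofReal_mul (abs_nonneg _)] at h1
    have h2 : |v| * κ x ≤ C.toReal := (ENNReal.ofReal_le_iff_le_toReal hC).1 h1
    have h3 : |v| ≤ C.toReal * (κ x)⁻¹ := by
      rw [← div_eq_mul_inv, le_div_iff₀ (hκpos x)]; exact h2
    exact h3.trans (mul_le_mul_of_nonneg_left ((hB x hx).trans (le_max_left _ _))
      ENNReal.toReal_nonneg)

/-- joint upper semicontinuity -/
lemma closed_super {κ : X → ℝ}
    {S : ℝ → (X → EReal) → (X → EReal)} (hS : AssumptionS κ S) {T : ℝ}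
    {K : Set X} (hK : IsCompact K) {f : X → EReal} (hf : MemUk κ f) (a : EReal) :
    IsClosed {p : ℝ × X | p ∈ Set.Icc 0 T ×ˢ K ∧ a ≤ S p.1 f p.2} := by
  rw [← isSeqClosed_iff_isClosed]
  intro u p hu hp
  have hcl : IsClosed (Set.Icc (0:ℝ) T ×ˢ K) := isClosed_Icc.prod hK.isClosed
  have hpm : p ∈ Set.Icc (0:ℝ) T ×ˢ K :=
    hcl.mem_of_tendsto hp (Eventually.of_forall fun n => (hu n).1)
  refine ⟨hpm, ?_⟩
  refine le_trans ?_ (hS.gammaUsc p.1 hpm.1.1 f hf p.2)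
  have h1 : Tendsto (fun n => (u n).1) atTop (𝓝 p.1) := (continuous_fst.tendsto p).comp hp
  have h2 : Tendsto (fun n => (u n).2) atTop (𝓝 p.2) := (continuous_snd.tendsto p).comp hp
  have h3 : a ≤ Filter.limsup (fun n => S (u n).1 f (u n).2) atTop := by
    calc a = Filter.limsup (fun _ : ℕ => a) atTop := (limsup_const a).symm
      _ ≤ _ := limsup_le_limsup (Eventually.of_forall fun n => (hu n).2)
  refine h3.trans ?_
  unfold gammaLimsupAt gammaLimsup
  refine le_trans ?_ (le_iSup _ (fun n => (u n).1))
  refine le_trans ?_ (le_iSup _ (fun n => (hu n).1.1.1))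
  refine le_trans ?_ (le_iSup _ h1)
  refine le_trans ?_ (le_iSup _ (fun n => (u n).2))
  exact le_iSup (fun _ : Tendsto (fun n => (u n).2) atTop (𝓝 p.2) =>
    Filter.limsup (fun n => S (u n).1 f (u n).2) atTop) h2

/-- Dini step -/
lemma dini_step {κ : X → ℝ} (hκc : Continuous κ) (hκpos : ∀ x, 0 < κ x)
    {S : ℝ → (X → EReal) → (X → EReal)} (hS : AssumptionS κ S) {r R T : ℝ} (hr : 0 ≤ r)
    (hrR : r ≤ R) {K : Set X} (hK : IsCompact K) (a : EReal) {F : Set X}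
    (hF : IsClosed F) {A : ℕ → Set X} (hA : ∀ n, IsClosed (A n)) (hAa : Antitone A)
    (hAe : ∀ x, ∃ n, x ∉ A n)
    (hlt : ∀ t, 0 ≤ t → t ≤ T → ∀ x ∈ K, S t (twoLevel κ r R F) x < a) :
    ∃ n, ∀ t, 0 ≤ t → t ≤ T → ∀ x ∈ K, S t (twoLevel κ r R (F ∪ A n)) x < a := by
  classical
  by_contra! hcon
  have hU : ∀ n, MemUk κ (twoLevel κ r R (F ∪ A n)) := fun n =>
    memUk_twoLevel hκc hκpos hr hrR (hF.union (hA n))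
  have hanti : ∀ x, Antitone fun n => twoLevel κ r R (F ∪ A n) x := by
    intro x m n hmn
    simp only [twoLevel]
    apply EReal.coe_le_coe_iff.2
    apply div_le_div_of_nonneg_right _ (hκpos x).le
    have hsub : x ∈ F ∪ A n → x ∈ F ∪ A m := fun h => h.imp id (fun h => hAa hmn h)
    by_cases h1 : x ∈ F ∪ A n
    · rw [if_pos h1, if_pos (hsub h1)]
    · rw [if_neg h1]; split_ifs <;> linarith
  set E : ℕ → Set (ℝ × X) := fun n =>
    {p : ℝ × X | p ∈ Set.Icc 0 T ×ˢ K ∧ a ≤ S p.1 (twoLevel κ r R (F ∪ A n)) p.2} with hE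
  have hEc : ∀ n, IsClosed (E n) := fun n => closed_super hS hK (hU n) a
  have hne : (⋂ n, E n).Nonempty := by
    apply IsCompact.nonempty_iInter_of_sequence_nonempty_isCompact_isClosed
    · intro n p hp
      refine ⟨hp.1, hp.2.trans ?_⟩
      exact hS.monotone p.1 hp.1.1.1 _ _ (hU _) (hU _)
        (fun x => hanti x (Nat.le_succ n)) p.2
    · intro n
      obtain ⟨t, ht, htT, x, hx, h⟩ := hcon n
      exact ⟨(t, x), ⟨⟨ht, htT⟩, hx⟩, h⟩
    · exact (isCompact_Icc.prod hK).of_isClosed_subset (hEc 0) fun p hp => hp.1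
    · exact hEc
  obtain ⟨p, hp⟩ := hne
  rw [Set.mem_iInter] at hp
  have hp0 := (hp 0).1
  have hlim := hS.contAbove p.1 hp0.1.1 (fun n => twoLevel κ r R (F ∪ A n))
    (twoLevel κ r R F) hU (memUk_twoLevel hκc hκpos hr hrR hF) hanti (by
      intro x
      apply le_antisymm
      · obtain ⟨n, hn⟩ := hAe x
        refine iInf_le_of_le n (le_of_eq ?_)
        simp [twoLevel, hn]
      · refine le_iInf fun n => ?_
        simp only [twoLevel]
        apply EReal.coe_le_coe_iff.2
        apply div_le_div_of_nonneg_right _ (hκpos x).le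
        by_cases h1 : x ∈ F
        · rw [if_pos h1, if_pos (Set.mem_union_left _ h1)]
        · rw [if_neg h1]; split_ifs <;> linarith) p.2
  have h1 := hlt p.1 hp0.1.1 hp0.1.2 p.2 hp0.2
  rw [← hlim] at h1
  exact absurd (le_iInf fun n => (hp n).2) (not_le.2 h1)

/-- Key tightness lemma -/
lemma key_tight [CompleteSpace X] [TopologicalSpace.SeparableSpace X]
    {κ : X → ℝ} (hκc : Continuous κ) (hκpos : ∀ x, 0 < κ x)
    {S : ℝ → (X → EReal) → (X → EReal)} (hS : AssumptionS κ S) {r r' R T : ℝ} (hr' : 0 ≤ r')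
    (hr'r : r < r') (hrR : r' ≤ R) {K : Set X} (hK : IsCompact K) (a : EReal)
    (hlt : ∀ t, 0 ≤ t → t ≤ T → ∀ x ∈ K, S t (ecoe fun x => r' / κ x) x < a) :
    ∃ K' : Set X, IsCompact K' ∧ ∀ f : X → ℝ, MemCk κ f → (∀ x, f x * κ x ≤ R) →
      (∀ x ∈ K', f x * κ x ≤ r) →
      ∀ t, 0 ≤ t → t ≤ T → ∀ x ∈ K, S t (ecoe f) x ≤ a := by
  classical
  rcases isEmpty_or_nonempty X with hX | hX
  · exact ⟨∅, isCompact_empty, fun f _ _ _ t _ _ x _ => hX.elim x⟩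
  let xs : ℕ → X := TopologicalSpace.denseSeq X
  have hxs : DenseRange xs := TopologicalSpace.denseRange_denseSeq X
  let A : ℕ → ℕ → Set X := fun k n => {x | ∀ i ≤ n, 1 / ((k:ℝ) + 1) ≤ dist x (xs i)}
  have hA : ∀ k n, IsClosed (A k n) := by
    intro k n
    have : A k n = ⋂ i, ⋂ (_ : i ≤ n), {x | 1 / ((k:ℝ) + 1) ≤ dist x (xs i)} := by
      ext x; simp [A]
    rw [this]
    exact isClosed_iInter fun i => isClosed_iInter fun _ =>
      isClosed_le continuous_const (continuous_id.dist continuous_const)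
  have hAa : ∀ k, Antitone (A k) := fun k m n hmn x hx i hi => hx i (hi.trans hmn)
  have hAe : ∀ k x, ∃ n, x ∉ A k n := by
    intro k x
    obtain ⟨i, hi⟩ := hxs.exists_dist_lt x (ε := 1 / ((k:ℝ) + 1)) (by positivity)
    exact ⟨i, fun h => absurd (h i le_rfl) (not_le.2 hi)⟩
  -- recursive construction
  let P := {F : Set X // IsClosed F ∧
    ∀ t, 0 ≤ t → t ≤ T → ∀ x ∈ K, S t (twoLevel κ r' R F) x < a}
  have hstep : ∀ (k : ℕ) (F : P), ∃ n, ∀ t, 0 ≤ t → t ≤ T → ∀ x ∈ K,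
      S t (twoLevel κ r' R (F.1 ∪ A k n)) x < a := fun k F =>
    dini_step hκc hκpos hS hr' hrR hK a F.2.1 (hA k) (hAa k) (hAe k) F.2.2
  choose N hN using hstep
  have h0 : twoLevel κ r' R ∅ = ecoe fun x => r' / κ x := by
    funext x; simp [twoLevel, ecoe]
  let Fs : ℕ → P := fun k => Nat.rec (motive := fun _ => P)
    ⟨∅, isClosed_empty, by rw [h0]; exact hlt⟩
    (fun k F => ⟨F.1 ∪ A k (N k F), F.2.1.union (hA _ _), hN k F⟩) k
  have hFs : ∀ k, (Fs (k+1)).1 = (Fs k).1 ∪ A k (N k (Fs k)) := fun k => rfl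
  have hAF : ∀ k m, k < m → A k (N k (Fs k)) ⊆ (Fs m).1 := by
    intro k m hkm
    induction m with
    | zero => omega
    | succ m ih =>
      rw [hFs m]
      rcases Nat.lt_succ_iff_lt_or_eq.1 hkm with h | h
      · exact (ih h).trans Set.subset_union_left
      · subst h; exact Set.subset_union_right
  let B : ℕ → Set X := fun k => ⋃ i ∈ Finset.range (N k (Fs k) + 1),
    Metric.closedBall (xs i) (1 / ((k:ℝ) + 1))
  have hBc : ∀ k, IsClosed (B k) := fun k =>
    isClosed_biUnion_finset fun i _ => Metric.isClosed_closedBall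
  have hBF : ∀ k m x, k < m → x ∉ (Fs m).1 → x ∈ B k := by
    intro k m x hkm hx
    have h1 : x ∉ A k (N k (Fs k)) := fun h => hx (hAF k m hkm h)
    simp only [A, Set.mem_ofPred_eq, not_forall, not_le] at h1
    obtain ⟨i, hi, h⟩ := h1
    simp only [B, Set.mem_iUnion]
    exact ⟨i, Finset.mem_range.2 (by omega), h.le⟩
  -- small balls
  have hsmall : ∀ ε > (0:ℝ), ∃ k : ℕ, 1 / ((k:ℝ) + 1) < ε := fun ε hε =>
    exists_nat_one_div_lt hε
  refine ⟨⋂ k, B k, ?_, ?_⟩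
  · refine TotallyBounded.isCompact_of_isClosed ?_ (isClosed_iInter hBc)
    rw [Metric.totallyBounded_iff]
    intro ε hε
    obtain ⟨k, hk⟩ := hsmall ε hε
    refine ⟨xs '' (Finset.range (N k (Fs k) + 1) : Set ℕ), (Finset.finite_toSet _).image _, ?_⟩
    intro x hx
    have := Set.mem_iInter.1 hx k
    simp only [B, Set.mem_iUnion] at this
    obtain ⟨i, hi, h⟩ := this
    simp only [Set.mem_iUnion]
    exact ⟨xs i, ⟨i, hi, rfl⟩, lt_of_le_of_lt h hk⟩
  · intro f hf hfR hfr t ht htT x hx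
    obtain ⟨m, hm⟩ : ∃ m, ∀ y, y ∉ (Fs m).1 → f y * κ y ≤ r' := by
      by_contra! hcon
      choose y hyF hyr using hcon
      have htb : TotallyBounded (Set.range y) := by
        rw [Metric.totallyBounded_iff]
        intro ε hε
        obtain ⟨k, hk⟩ := hsmall ε hε
        refine ⟨xs '' (Finset.range (N k (Fs k) + 1) : Set ℕ) ∪
          y '' (Finset.range (k + 1) : Set ℕ),
          ((Finset.finite_toSet _).image _).union ((Finset.finite_toSet _).image _), ?_⟩
        rintro _ ⟨m, rfl⟩
        simp only [Set.mem_iUnion]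
        by_cases hm : k < m
        · have := hBF k m (y m) hm (hyF m)
          simp only [B, Set.mem_iUnion] at this
          obtain ⟨i, hi, h⟩ := this
          exact ⟨xs i, Or.inl ⟨i, hi, rfl⟩, lt_of_le_of_lt h hk⟩
        · refine ⟨y m, Or.inr ⟨m, ?_, rfl⟩, Metric.mem_ball_self hε⟩
          simp only [Finset.coe_range, Set.mem_Iio]; omega
      have hcpt : IsCompact (closure (Set.range y)) :=
        htb.closure.isCompact_of_isClosed isClosed_closure
      obtain ⟨z, _, φ, hφ, hz⟩ := hcpt.tendsto_subseq
        (fun n => subset_closure (Set.mem_range_self n))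
      have hzB : z ∈ ⋂ k, B k := by
        refine Set.mem_iInter.2 fun k => (hBc k).mem_of_tendsto hz ?_
        filter_upwards [eventually_gt_atTop k] with n hn
        exact hBF k (φ n) _ (lt_of_lt_of_le hn (hφ.id_le n)) (hyF _)
      have h1 : r' ≤ f z * κ z := by
        have hc : Tendsto (fun n => f (y (φ n)) * κ (y (φ n))) atTop (𝓝 (f z * κ z)) :=
          ((hf.1.mul hκc).tendsto z).comp hz
        exact ge_of_tendsto hc (Eventually.of_forall fun n => (hyr _).le)
      linarith [hfr z hzB]
    refine le_trans ?_ ((Fs m).2.2 t ht htT x hx).le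
    refine hS.monotone t ht _ _ (memUk_ecoe hκpos hf)
      (memUk_twoLevel hκc hκpos hr' hrR (Fs m).2.1) (fun y => ?_) x
    simp only [twoLevel, ecoe]
    apply EReal.coe_le_coe_iff.2
    rw [le_div_iff₀ (hκpos y)]
    split_ifs with h
    · exact hfR y
    · exact hm y h

/-- The one-sided convexity estimate -/
lemma one_sided {κ : X → ℝ} (hκpos : ∀ x, 0 < κ x)
    {S : ℝ → (X → EReal) → (X → EReal)} (hS : AssumptionS κ S) {t : ℝ} (ht : 0 ≤ t)
    {f g : X → ℝ} (hf : MemCk κ f) (hg : MemCk κ g) {p : ℝ} (hp : 0 < p) (hp1 : p ≤ 1)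
    (hh : MemCk κ fun y => g y + (f y - g y) / p) {x : X} {a v w : ℝ}
    (ha : S t (ecoe fun y => g y + (f y - g y) / p) x ≤ (a : EReal))
    (hv : S t (ecoe f) x = (v : EReal)) (hw : S t (ecoe g) x = (w : EReal)) :
    v - w ≤ p * (a - w) := by
  have h := hS.convex t ht _ _ (memUk_ecoe hκpos hh) (memUk_ecoe hκpos hg) p hp.le hp1 x
  have he : (fun y => (p : EReal) * ecoe (fun y => g y + (f y - g y) / p) y
      + ((1 - p : ℝ) : EReal) * ecoe g y) = ecoe f := by
    funext y
    simp only [ecoe]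
    rw [← EReal.coe_mul, ← EReal.coe_mul, ← EReal.coe_add]
    apply congrArg
    have : p * ((f y - g y) / p) = f y - g y := mul_div_cancel₀ _ hp.ne'
    linarith
  rw [he, hv, hw] at h
  have h2 : (v : EReal) ≤ (p : EReal) * (a : EReal) + ((1 - p : ℝ) : EReal) * (w : EReal) := by
    refine h.trans ?_
    gcongr
  rw [← EReal.coe_mul, ← EReal.coe_mul, ← EReal.coe_add, EReal.coe_le_coe_iff] at h2
  linarith

lemma memCk_comb {κ : X → ℝ} (hκpos : ∀ x, 0 < κ x) {f g : X → ℝ} {r p : ℝ}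
    (hf : MemCk κ f) (hg : MemCk κ g)
    (hfr : CkBound κ r f) (hgr : CkBound κ r g) (hp : 0 < p) :
    MemCk κ (fun y => g y + (f y - g y) / p) ∧
      ∀ y, (g y + (f y - g y) / p) * κ y ≤ r + 2 * r / p := by
  have hb : ∀ y, |g y + (f y - g y) / p| * κ y ≤ r + 2 * r / p := by
    intro y
    have h1 : |g y + (f y - g y) / p| ≤ |g y| + (|f y| + |g y|) / p := by
      refine (abs_add_le _ _).trans ?_
      rw [abs_div, abs_of_pos hp]
      gcongr
      exact abs_sub _ _
    calc _ ≤ (|g y| + (|f y| + |g y|) / p) * κ y :=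
          mul_le_mul_of_nonneg_right h1 (hκpos y).le
      _ = |g y| * κ y + (|f y| * κ y + |g y| * κ y) / p := by ring
      _ ≤ r + (r + r) / p := by
          have := hfr y
          have := hgr y
          gcongr
      _ = _ := by ring
  refine ⟨⟨hg.1.add ((hf.1.sub hg.1).div_const p), _, hb⟩, fun y => le_trans ?_ (hb y)⟩
  exact mul_le_mul_of_nonneg_right (le_abs_self _) (hκpos y).le

/-- First part of the theorem, in real form. -/
lemma main_est [CompleteSpace X] [TopologicalSpace.SeparableSpace X]
    {κ : X → ℝ} (hκc : Continuous κ) (hκpos : ∀ x, 0 < κ x) (hκbd : ∃ C, ∀ x, κ x ≤ C)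
    {S : ℝ → (X → EReal) → (X → EReal)} (hS : AssumptionS κ S)
    {ε : ℝ} (hε : 0 < ε) {r T : ℝ} (hr : 0 ≤ r) (hT : 0 ≤ T) {K : Set X} (hK : IsCompact K) :
    ∃ K' : Set X, IsCompact K' ∧ ∃ c ≥ (0:ℝ), ∀ t, 0 ≤ t → t ≤ T →
      ∀ f g : X → ℝ, MemCk κ f → MemCk κ g → CkBound κ r f → CkBound κ r g →
        ∀ x ∈ K, ∃ v w : ℝ, S t (ecoe f) x = (v : EReal) ∧ S t (ecoe g) x = (w : EReal) ∧
          |v - w| ≤ c * (⨆ y : K', |f (y : X) - g (y : X)|) + ε := by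
  obtain ⟨C0, hC0⟩ := hκbd
  set C := max C0 0
  have hC : ∀ x, κ x ≤ C := fun x => (hC0 x).trans (le_max_left _ _)
  have hC00 : 0 ≤ C := le_max_right _ _
  set r' := r + C + 1 with hr'
  have hr'0 : 0 ≤ r' := by positivity
  obtain ⟨M, hM0, hM⟩ := real_bound hκc hκpos hS hr'0 hT hK
  set p := min 1 (ε / (2 * M + 1)) with hp
  have hp0 : 0 < p := by positivity
  have hp1 : p ≤ 1 := min_le_left _ _
  have hpe : p * (2 * M + 1) ≤ ε := by
    rw [← le_div_iff₀ (by positivity)]; exact min_le_right _ _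
  set R := r' + 2 * r / p with hR
  have hrR : r' ≤ R := by rw [hR]; linarith [show 0 ≤ 2 * r / p by positivity]
  have hkap : MemCk κ (fun x => r' / κ x) ∧ CkBound κ r' (fun x => r' / κ x) := by
    have hb : ∀ x, |r' / κ x| * κ x ≤ r' := by
      intro x
      rw [abs_of_nonneg (div_nonneg hr'0 (hκpos x).le), div_mul_cancel₀ _ (hκpos x).ne']
    exact ⟨⟨continuous_const.div hκc fun x => (hκpos x).ne', r', hb⟩, hb⟩
  obtain ⟨K', hK', hkey⟩ := key_tight (r := r + C) (r' := r') (R := R) (T := T)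
    hκc hκpos hS hr'0 (by rw [hr']; linarith) hrR hK ((M + 1 : ℝ) : EReal) (by
      intro t ht htT x hx
      obtain ⟨v, hv, hvM⟩ := hM t ht htT _ hkap.1 hkap.2 x hx
      rw [hv]
      exact EReal.coe_lt_coe_iff.2 (by linarith [le_abs_self v]))
  refine ⟨K', hK', 2 * M / p, by positivity, ?_⟩
  intro t ht htT f g hf hg hfr hgr x hx
  have hup : ∀ f, CkBound κ r f → CkBound κ r' f := fun f h y =>
    (h y).trans (by rw [hr']; linarith)
  obtain ⟨v, hv, hvM⟩ := hM t ht htT f hf (hup f hfr) x hx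
  obtain ⟨w, hw, hwM⟩ := hM t ht htT g hg (hup g hgr) x hx
  refine ⟨v, w, hv, hw, ?_⟩
  have hbdd : BddAbove (Set.range fun y : K' => |f (y : X) - g (y : X)|) := by
    obtain ⟨b, hb⟩ := hK'.bddAbove_image (f := fun y => |f y - g y|)
      (hf.1.sub hg.1).abs.continuousOn
    exact ⟨b, by rintro _ ⟨y, rfl⟩; exact hb (Set.mem_image_of_mem _ y.2)⟩
  set δ := ⨆ y : K', |f (y : X) - g (y : X)| with hδ
  have hδ0 : 0 ≤ δ := Real.iSup_nonneg fun y => abs_nonneg _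
  have hle : ∀ y ∈ K', |f y - g y| ≤ δ := fun y hy => le_ciSup hbdd ⟨y, hy⟩
  have hvw := abs_le.1 hvM
  have hww := abs_le.1 hwM
  by_cases hd : δ ≤ p
  · have main : ∀ f g : X → ℝ, MemCk κ f → MemCk κ g → CkBound κ r f → CkBound κ r g →
        (∀ y ∈ K', |f y - g y| ≤ δ) → ∀ v w : ℝ, S t (ecoe f) x = (v : EReal) →
        S t (ecoe g) x = (w : EReal) → |w| ≤ M → v - w ≤ ε := by
      intro f g hf hg hfr hgr hle v w hv hw hwM
      obtain ⟨hh, hhb⟩ := memCk_comb hκpos hf hg hfr hgr hp0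
      have h1 := hkey _ hh (fun y => (hhb y).trans (by rw [hR, hr']; linarith)) (by
        intro y hy
        have h2 : (f y - g y) / p ≤ 1 := by
          rw [div_le_one hp0]; exact (le_abs_self _).trans ((hle y hy).trans hd)
        have h3 : g y * κ y ≤ r :=
          (mul_le_mul_of_nonneg_right (le_abs_self _) (hκpos y).le).trans (hgr y)
        have h4 : (f y - g y) / p * κ y ≤ 1 * κ y :=
          mul_le_mul_of_nonneg_right h2 (hκpos y).le
        rw [add_mul]
        linarith [hC y]) t ht htT x hx
      have h5 := one_sided hκpos hS ht hf hg hp0 hp1 hh h1 hv hw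
      refine h5.trans (le_trans ?_ hpe)
      exact mul_le_mul_of_nonneg_left (by linarith [(abs_le.1 hwM).1]) hp0.le
    have h1 := main f g hf hg hfr hgr hle v w hv hw hwM
    have h2 := main g f hg hf hgr hfr (fun y hy => by rw [abs_sub_comm]; exact hle y hy)
      w v hw hv hvM
    have h3 : 0 ≤ 2 * M / p * δ := by positivity
    rw [abs_le]; constructor <;> linarith
  · push Not at hd
    have h3 : 2 * M ≤ 2 * M / p * δ := by
      calc 2 * M = 2 * M / p * p := by field_simp
        _ ≤ _ := mul_le_mul_of_nonneg_left hd.le (by positivity)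
    rw [abs_le]; constructor <;> linarith

end helpers

/-- uniform continuity estimate on compact sets for `S(t)`, and continuity
of `S(t)` with respect to the mixed topology. -/
theorem stmt9
    {X : Type*} [MetricSpace X] [CompleteSpace X] [TopologicalSpace.SeparableSpace X]
    (κ : X → ℝ) (hκc : Continuous κ) (hκpos : ∀ x, 0 < κ x) (hκbd : ∃ C, ∀ x, κ x ≤ C)
    (S : ℝ → (X → EReal) → (X → EReal)) (hS : AssumptionS κ S) :
    (∀ ε > (0:ℝ), ∀ r T : ℝ, 0 ≤ r → 0 ≤ T → ∀ K : Set X, IsCompact K →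
      ∃ K' : Set X, IsCompact K' ∧ ∃ c ≥ (0:ℝ), ∀ t, 0 ≤ t → t ≤ T →
        ∀ f g : X → ℝ, MemCk κ f → MemCk κ g → CkBound κ r f → CkBound κ r g →
          ∀ x ∈ K, (S t (ecoe f) x - S t (ecoe g) x).abs ≤
            ENNReal.ofReal (c * (⨆ y : K', |f (y : X) - g (y : X)|) + ε)) ∧
    (∀ t, 0 ≤ t → ∀ (fn : ℕ → X → ℝ) (f : X → ℝ), (∀ n, MemCk κ (fn n)) → MemCk κ f →
      (∃ r : ℝ, ∀ n, CkBound κ r (fn n)) →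
      (∀ K : Set X, IsCompact K → TendstoUniformlyOn (fun n => fn n) f atTop K) →
      ∀ K : Set X, IsCompact K → ∀ ε > (0:ℝ), ∃ N : ℕ, ∀ n ≥ N, ∀ x ∈ K,
        S t (ecoe (fn n)) x ≤ S t (ecoe f) x + (ε : EReal) ∧
        S t (ecoe f) x ≤ S t (ecoe (fn n)) x + (ε : EReal)) := by
  refine ⟨?_, ?_⟩
  · intro ε hε r T hr hT K hK
    obtain ⟨K', hK', c, hc, h⟩ := main_est hκc hκpos hκbd hS hε hr hT hK
    refine ⟨K', hK', c, hc, fun t ht htT f g hf hg hfr hgr x hx => ?_⟩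
    obtain ⟨v, w, hv, hw, hvw⟩ := h t ht htT f g hf hg hfr hgr x hx
    rw [hv, hw, ← EReal.coe_sub, EReal.abs_def]
    exact ENNReal.ofReal_le_ofReal hvw
  · intro t ht fn f hfn hf hbd hun K hK ε hε
    obtain ⟨r1, hr1⟩ := hbd
    obtain ⟨r2, hr2⟩ := hf.2
    obtain ⟨K', hK', c, hc, h⟩ := main_est hκc hκpos hκbd hS (half_pos hε)
      (r := max (max r1 r2) 0) (le_max_right _ _) ht hK
    have hpos : 0 < ε / (2 * (c + 1)) := by positivity
    obtain ⟨N, hN⟩ := eventually_atTop.1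
      (Metric.tendstoUniformlyOn_iff.1 (hun K' hK') _ hpos)
    refine ⟨N, fun n hn x hx => ?_⟩
    obtain ⟨v, w, hv, hw, hvw⟩ := h t ht le_rfl (fn n) f (hfn n) hf
      (fun y => (hr1 n y).trans ((le_max_left _ _).trans (le_max_left _ _)))
      (fun y => (hr2 y).trans ((le_max_right _ _).trans (le_max_left _ _))) x hx
    have h1 : (⨆ y : K', |fn n (y : X) - f (y : X)|) ≤ ε / (2 * (c + 1)) := by
      apply Real.iSup_le _ hpos.le
      intro y
      have := hN n hn y y.2
      rw [dist_comm, Real.dist_eq] at this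
      exact this.le
    have h2 : c * (⨆ y : K', |fn n (y : X) - f (y : X)|) ≤ ε / 2 := by
      calc _ ≤ c * (ε / (2 * (c + 1))) := mul_le_mul_of_nonneg_left h1 hc
        _ ≤ (c + 1) * (ε / (2 * (c + 1))) := by gcongr; linarith
        _ = ε / 2 := by field_simp
    have h3 := abs_le.1 (hvw.trans (by linarith : _ ≤ ε))
    rw [hv, hw, ← EReal.coe_add, ← EReal.coe_add, EReal.coe_le_coe_iff, EReal.coe_le_coe_iff]
    constructor <;> linarith [h3.1, h3.2]
end

section
/- Let (S(t))_{t≥0} satisfy Assumption S. Then S(t) maps the upper Lipschitz set L^S_+ into itself for every t ≥ 0. -/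
open Filter MeasureTheory Topology
open scoped ENNReal Topology

theorem MemCk.memUk_aux {X : Type*} [MetricSpace X] {κ : X → ℝ} (hκpos : ∀ x, 0 < κ x)
    {f : X → ℝ} (hf : MemCk κ f) : MemUk κ (ecoe f) := by
  obtain ⟨hc, r, hr⟩ := hf
  refine ⟨?_, fun x => EReal.coe_lt_top _, |r|, fun x => ?_⟩
  · exact (continuous_coe_real_ereal.comp hc).upperSemicontinuous
  · have h1 : max (f x) 0 * κ x ≤ |r| := by
      have h2 : max (f x) 0 ≤ |f x| := max_le (le_abs_self _) (abs_nonneg _)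
      have := mul_le_mul_of_nonneg_right h2 (hκpos x).le
      linarith [hr x, le_abs_self r]
    show max ((f x : ℝ) : EReal) 0 * (κ x : EReal) ≤ _
    have h3 : max ((f x : ℝ) : EReal) 0 = ((max (f x) 0 : ℝ) : EReal) := by
      rw [EReal.coe_strictMono.monotone.map_max, EReal.coe_zero]
    rw [h3, ← EReal.coe_mul]
    exact_mod_cast h1

theorem max_sub_aux (a b k r : ℝ) :
    max ((a : EReal) - (b : EReal)) 0 * (k : EReal) ≤ (r : EReal) ↔ max (a - b) 0 * k ≤ r := by
  have h3 : max ((a : EReal) - (b : EReal)) 0 = ((max (a - b) 0 : ℝ) : EReal) := by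
    rw [EReal.coe_strictMono.monotone.map_max, EReal.coe_zero, EReal.coe_sub]
  rw [h3, ← EReal.coe_mul, EReal.coe_le_coe_iff]

/-- invariance of the upper Lipschitz set `L^S_+` under the semigroup. -/
theorem stmt10
    {X : Type*} [MetricSpace X] [CompleteSpace X] [TopologicalSpace.SeparableSpace X]
    (κ : X → ℝ) (hκc : Continuous κ) (hκpos : ∀ x, 0 < κ x) (hκbd : ∃ C, ∀ x, κ x ≤ C)
    (S : ℝ → (X → EReal) → (X → EReal)) (hS : AssumptionS κ S)
    (t : ℝ) (ht : 0 ≤ t) (f : X → ℝ) (hf : UpperLip κ S f)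
    (g : X → ℝ) (hg : ∀ x, S t (ecoe f) x = (g x : EReal)) :
    UpperLip κ S g := by
  have hgS : ecoe g = S t (ecoe f) := funext fun x => (hg x).symm
  obtain ⟨hfC, hfS, hsemi, h₀, hh₀, c, hc, hlip⟩ := hf
  have hgC : MemCk κ g := by
    obtain ⟨g', hg', he⟩ := hfS t ht
    have : g = g' := funext fun x => by
      have := (hg x).symm.trans (he x)
      exact_mod_cast this
    rwa [this]
  have hSg : ∀ s, 0 ≤ s → S s (ecoe g) = S (s + t) (ecoe f) := fun s hs => by
    rw [hgS, hsemi s t hs ht]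
  have hfU := hfC.memUk_aux hκpos
  set k : X → ℝ := fun x => f x + c / κ x with hk
  have hcomb : ∀ a : ℝ, 0 ≤ a → MemCk κ (fun x => f x + a / κ x) := fun a ha => by
    obtain ⟨hfc, r, hr⟩ := hfC
    refine ⟨hfc.add (continuous_const.div hκc fun x => (hκpos x).ne'), r + a, fun x => ?_⟩
    have h1 : |f x + a / κ x| ≤ |f x| + a / κ x := by
      refine (abs_add_le _ _).trans ?_
      rw [abs_of_nonneg (div_nonneg ha (hκpos x).le)]
    have h2 := mul_le_mul_of_nonneg_right h1 (hκpos x).le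
    have h3 : a / κ x * κ x = a := div_mul_cancel₀ _ (hκpos x).ne'
    nlinarith [hr x]
  have hkU : MemUk κ (ecoe k) := (hcomb c hc).memUk_aux hκpos
  obtain ⟨-, hutop, r, hr⟩ := hS.maps t ht _ hkU
  obtain ⟨R, hR⟩ := hgC.2
  refine ⟨hgC, fun s hs => ?_, fun s s' hs hs' => ?_, min h₀ 1, lt_min hh₀ one_pos,
    |r| + |R|, by positivity, fun h hh hhle x => ?_⟩
  · rw [hSg s hs]
    exact hfS _ (by positivity)
  · rw [hSg _ (by positivity), hSg s' hs', ← hsemi s (s' + t) hs (by positivity), add_assoc]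
  · have hle0 : h ≤ h₀ := hhle.trans (min_le_left _ _)
    have hle1 : h ≤ 1 := hhle.trans (min_le_right _ _)
    obtain ⟨w, hwC, hw⟩ := hfS (h + t) (by positivity)
    obtain ⟨v, hvC, hv⟩ := hfS h hh
    have hvU : MemUk κ (S h (ecoe f)) := hS.maps h hh _ hfU
    have hfun : (fun y => (h : EReal) * ecoe k y + ((1 - h : ℝ) : EReal) * ecoe f y)
        = ecoe (fun x => f x + (c * h) / κ x) := by
      funext y
      simp only [ecoe, hk]
      rw [← EReal.coe_mul, ← EReal.coe_mul, ← EReal.coe_add]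
      congr 1
      ring
    have hmU : MemUk κ (ecoe (fun x => f x + (c * h) / κ x)) :=
      (hcomb (c * h) (by positivity)).memUk_aux hκpos
    have hle : ∀ y, S h (ecoe f) y ≤ ecoe (fun x => f x + (c * h) / κ x) y := fun y => by
      have h1 := hlip h hh hle0 y
      rw [hv y, max_sub_aux] at h1
      rw [hv y]
      show (v y : EReal) ≤ ((f y + c * h / κ y : ℝ) : EReal)
      rw [EReal.coe_le_coe_iff]
      have h2 : v y - f y ≤ c * h / κ y := by
        rw [le_div_iff₀ (hκpos y)]
        exact (mul_le_mul_of_nonneg_right (le_max_left _ _) (hκpos y).le).trans h1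
      linarith
    have hA := hS.monotone t ht _ _ hvU hmU hle x
    have hB := hS.convex t ht _ _ hkU hfU h hh hle1 x
    rw [hfun] at hB
    have hAB := hA.trans hB
    rw [← hsemi t h ht hh, add_comm t h, hw x, hg x] at hAB
    rw [hSg h hh, hw x, max_sub_aux]
    -- bound of `S t k` by a real number
    have hmne : max (S t (ecoe k) x) 0 ≠ ⊤ := (max_lt (hutop x) EReal.zero_lt_top).ne
    have hmbot : max (S t (ecoe k) x) 0 ≠ ⊥ :=
      (lt_of_lt_of_le EReal.bot_lt_zero (le_max_right _ _)).ne'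
    obtain ⟨p, hp⟩ : ∃ p : ℝ, max (S t (ecoe k) x) 0 = (p : EReal) :=
      ⟨_, (EReal.coe_toReal hmne hmbot).symm⟩
    have hrx := hr x
    rw [hp, ← EReal.coe_mul, EReal.coe_le_coe_iff] at hrx
    have hup : S t (ecoe k) x ≤ (p : EReal) := hp ▸ le_max_left _ _
    have hfin : (w x : EReal) ≤ ((h * p + (1 - h) * g x : ℝ) : EReal) := by
      refine hAB.trans ?_
      rw [EReal.coe_add, EReal.coe_mul, EReal.coe_mul]
      exact add_le_add (mul_le_mul_of_nonneg_left hup (by exact_mod_cast hh)) le_rfl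
    rw [EReal.coe_le_coe_iff] at hfin
    have hκx := hκpos x
    have h5 : -(g x) * κ x ≤ |R| :=
      (mul_le_mul_of_nonneg_right (neg_le_abs _) hκx.le).trans ((hR x).trans (le_abs_self _))
    have h6 : (p - g x) * κ x ≤ |r| + |R| := by
      have := le_abs_self r
      nlinarith
    have h7 : (w x - g x) * κ x ≤ (|r| + |R|) * h := by
      have h8 : w x - g x ≤ h * (p - g x) := by linarith
      have h9 := mul_le_mul_of_nonneg_right h8 hκx.le
      have h10 := mul_le_mul_of_nonneg_left h6 hh
      nlinarith
    rcases max_cases (w x - g x) 0 with h8 | h8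
    · rw [h8.1]; exact h7
    · rw [h8.1, zero_mul]; positivity
end
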